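/- arXiv:1301.2149 — 2 statements merged into one kernel-verified Lean document; each statement's English description precedes it below -/
import Mathlib

section
/- Uniform lower bound for the quadratic F_λ in the Carleman proof: Let x0 < 0, a0 > 0, a ∈ 𝒜(x0,a0), let β satisfy −min_{x∈[0,1]}(a(x)+(x−x0)a'(x)) < β < min_{x∈[0,1]}(a(x)+(1/2)(x−x0)a'(x)), and let α ∈ ℝ. For x ∈ [0,1] and Y ∈ ℝ define F_λ(x,Y) = 2λY² + [4β + α(2β + a(x) + (x−x0)a'(x))]·Y + 8a(x)(x−x0)²·(−2β + 2a(x) + (x−x0)a'(x)). Then there exist λ0 > 0 and M > 0 such that F_λ(x,Y) ≥ M for all λ ≥ λ0, all x ∈ [0,1] and all Y ∈ ℝ. -/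
open Set

/-- The admissible class `𝒜(x0, a0)` of coefficients. -/
def memA (x0 a0 : ℝ) (a : ℝ → ℝ) : Prop :=
  ContDiff ℝ 3 a ∧ (∀ x ∈ Set.Icc (0:ℝ) 1, a0 ≤ a x) ∧
    -sInf ((fun x => a x + (x - x0) * deriv a x) '' Set.Icc (0:ℝ) 1) <
      sInf ((fun x => a x + (1/2) * (x - x0) * deriv a x) '' Set.Icc (0:ℝ) 1)

/-- Uniform lower bound for the quadratic `F_λ` in the Carleman proof. -/
theorem Flambda_uniform_lower_bound
    (x0 a0 : ℝ) (hx0 : x0 < 0) (ha0 : 0 < a0)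
    (a : ℝ → ℝ) (ha : memA x0 a0 a)
    (β : ℝ)
    (hβ1 : -sInf ((fun x => a x + (x - x0) * deriv a x) '' Set.Icc (0:ℝ) 1) < β)
    (hβ2 : β < sInf ((fun x => a x + (1/2) * (x - x0) * deriv a x) '' Set.Icc (0:ℝ) 1))
    (α : ℝ) :
    ∃ lam0 > (0:ℝ), ∃ M > (0:ℝ), ∀ lam ≥ lam0, ∀ x ∈ Set.Icc (0:ℝ) 1, ∀ Y : ℝ,
      M ≤ 2 * lam * Y^2
            + (4 * β + α * (2 * β + a x + (x - x0) * deriv a x)) * Y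
            + 8 * a x * (x - x0)^2 * (-2 * β + 2 * a x + (x - x0) * deriv a x) := by
  have hcd : Continuous (deriv a) := ha.1.continuous_deriv (by norm_num)
  have hc : Continuous a := ha.1.continuous
  set m := sInf ((fun x => a x + (1/2) * (x - x0) * deriv a x) '' Set.Icc (0:ℝ) 1)
  have hmle : ∀ x ∈ Set.Icc (0:ℝ) 1, m ≤ a x + (1/2) * (x - x0) * deriv a x := fun x hx =>
    csInf_le (isCompact_Icc.image (by fun_prop)).bddBelow (Set.mem_image_of_mem _ hx)
  obtain ⟨C, hC⟩ := (isCompact_Icc (a := (0:ℝ)) (b := 1)).exists_bound_of_continuousOn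
    (f := fun x => 4 * β + α * (2 * β + a x + (x - x0) * deriv a x))
    (Continuous.continuousOn (by fun_prop))
  have hδ : 0 < m - β := sub_pos.mpr hβ2
  have hx0sq : 0 < x0 ^ 2 := sq_pos_of_neg hx0
  set K := 16 * a0 * x0 ^ 2 * (m - β) with hK
  have hKpos : 0 < K := by positivity
  refine ⟨C ^ 2 / (4 * K) + 1, by positivity, K / 2, by positivity, fun lam hlam x hx Y => ?_⟩
  have hconst : K ≤ 8 * a x * (x - x0) ^ 2 * (-2 * β + 2 * a x + (x - x0) * deriv a x) := by
    have hsq : x0 ^ 2 ≤ (x - x0) ^ 2 := by nlinarith [hx.1]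
    have hax := ha.2.1 x hx
    have hlin : 2 * (m - β) ≤ -2 * β + 2 * a x + (x - x0) * deriv a x := by
      linarith [hmle x hx]
    calc K = 8 * a0 * x0 ^ 2 * (2 * (m - β)) := by rw [hK]; ring
      _ ≤ _ := by
        have : 0 ≤ a x := ha0.le.trans hax
        gcongr
  have hb := hC x hx
  simp only [Real.norm_eq_abs] at hb
  generalize 4 * β + α * (2 * β + a x + (x - x0) * deriv a x) = b at hb ⊢
  have hbC : b ^ 2 ≤ C ^ 2 := sq_le_sq' (abs_le.mp hb).1 (abs_le.mp hb).2
  have hCl : C ^ 2 ≤ 4 * lam * K := by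
    have h : C ^ 2 / (4 * K) ≤ lam := by linarith
    rw [div_le_iff₀ (by positivity)] at h
    linarith
  have hlampos : 0 < lam := by
    have : 0 ≤ C ^ 2 / (4 * K) := by positivity
    linarith
  have hquad : 0 ≤ 2 * lam * Y ^ 2 + b * Y + K / 2 := by
    refine nonneg_of_mul_nonneg_right (a := 8 * lam) ?_ (by positivity)
    nlinarith [sq_nonneg (4 * lam * Y + b)]
  linarith
end

section
/- Exact values of the Hermite error integrals (the computations of Section 3.3): Let Δx > 0, Δt > 0, let K = [x_k, x_k+Δx] × [t_l, t_l+Δt], and define the Hermite basis functions on [x_k, x_k+Δx] by, with c = (x−x_k)/Δx, L_0(x) = (1+2c)(1−c)², L_1(x) = c²(3−2c), L_2(x) = Δx·c(1−c)², L_3(x) = Δx·c²(c−1), and analogously 𝓛_0, 𝓛_1, 𝓛_2, 𝓛_3 on [t_l, t_l+Δt] with c replaced by (t−t_l)/Δt. Writing x_{k+0} = x_k, x_{k+1} = x_k+Δx, t_{l+0} = t_l, t_{l+1} = t_l+Δt, define for i, j ∈ {0,1}: m_{ij}(x,t) = (L_i(x)(x−x_{k+i}) − L_{i+2}(x))·𝓛_j(t),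 n_{ij}(x,t) = L_i(x)·(𝓛_j(t)(t−t_{l+j}) − 𝓛_{j+2}(t)), p_{ij}(x,t) = L_i(x)𝓛_j(t)(x−x_{k+i})(t−t_{l+j}) − L_{i+2}(x)𝓛_{j+2}(t). Then Σ_{i,j=0}^{1} ∬_K |m_{ij}|² dx dt = (104/11025)·(Δx)³·Δt, Σ_{i,j=0}^{1} ∬_K |n_{ij}|² dx dt = (104/11025)·Δx·(Δt)³, and Σ_{i,j=0}^{1} ∬_K |p_{ij}|² dx dt = (353/198450)·(Δx)³·(Δt)³. -/
open intervalIntegral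

/-- The cubic Hermite basis functions `L_0, L_1, L_2, L_3` of the interval
`[x0, x0 + h]` (indices `≥ 4` are irrelevant and set to `0`). -/
noncomputable def hermite (x0 h : ℝ) : ℕ → ℝ → ℝ := fun i x =>
  match i with
  | 0 => (1 + 2 * ((x - x0) / h)) * (1 - (x - x0) / h)^2
  | 1 => ((x - x0) / h)^2 * (3 - 2 * ((x - x0) / h))
  | 2 => h * ((x - x0) / h) * (1 - (x - x0) / h)^2
  | 3 => h * ((x - x0) / h)^2 * ((x - x0) / h - 1)
  | _ => 0

/-- The error kernel `m_{ij}(x,t) = (L_i(x)(x−x_{k+i}) − L_{i+2}(x))·𝓛_j(t)`. -/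
noncomputable def mker (xk dx tl dt : ℝ) (i j : ℕ) (x t : ℝ) : ℝ :=
  (hermite xk dx i x * (x - (xk + (i : ℝ) * dx)) - hermite xk dx (i + 2) x) *
    hermite tl dt j t

/-- The error kernel `n_{ij}(x,t) = L_i(x)·(𝓛_j(t)(t−t_{l+j}) − 𝓛_{j+2}(t))`. -/
noncomputable def nker (xk dx tl dt : ℝ) (i j : ℕ) (x t : ℝ) : ℝ :=
  hermite xk dx i x *
    (hermite tl dt j t * (t - (tl + (j : ℝ) * dt)) - hermite tl dt (j + 2) t)

/-- The error kernel
`p_{ij}(x,t) = L_i(x)𝓛_j(t)(x−x_{k+i})(t−t_{l+j}) − L_{i+2}(x)𝓛_{j+2}(t)`. -/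
noncomputable def pker (xk dx tl dt : ℝ) (i j : ℕ) (x t : ℝ) : ℝ :=
  hermite xk dx i x * hermite tl dt j t * (x - (xk + (i : ℝ) * dx)) *
      (t - (tl + (j : ℝ) * dt))
    - hermite xk dx (i + 2) x * hermite tl dt (j + 2) t

/-- The integral over `[x0, x0 + h]` of a function that is a polynomial in the normalized
variable `(x - x0) / h`. -/
lemma integral_of_eval_affine {n : ℕ} (x0 h s : ℝ) (f : ℝ → ℝ) (a : Fin n → ℝ)
    (hf : ∀ c, f (x0 + h * c) = s * ∑ i, a i * c ^ (i : ℕ)) :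
    ∫ x in x0..(x0 + h), f x = h * s * ∑ i, a i / ((i : ℕ) + 1) := by
  have key := mul_integral_comp_add_mul (a := 0) (b := 1) (f := f) h x0
  simp only [mul_zero, add_zero, mul_one] at key
  rw [← key, mul_assoc]
  simp only [hf]
  rw [intervalIntegral.integral_const_mul, intervalIntegral.integral_finsetSum]
  · simp [div_eq_mul_inv]
  · intro i _
    exact Continuous.intervalIntegrable (by fun_prop) _ _

lemma continuous_hermite (x0 h : ℝ) (i : ℕ) : Continuous (hermite x0 h i) := by
  unfold hermite
  split <;> fun_prop

lemma integral_integral_mul_sub_mul_sq {a b A B : ℝ → ℝ} (ha : Continuous a) (hb : Continuous b)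
    (hA : Continuous A) (hB : Continuous B) (x₁ x₂ t₁ t₂ : ℝ) :
    ∫ t in t₁..t₂, ∫ x in x₁..x₂, (a x * A t - b x * B t) ^ 2 =
      (∫ x in x₁..x₂, a x ^ 2) * (∫ t in t₁..t₂, A t ^ 2)
        - 2 * ((∫ x in x₁..x₂, a x * b x) * (∫ t in t₁..t₂, A t * B t))
        + (∫ x in x₁..x₂, b x ^ 2) * (∫ t in t₁..t₂, B t ^ 2) := by
  have inner (t : ℝ) : ∫ x in x₁..x₂, (a x * A t - b x * B t) ^ 2 =
      (∫ x in x₁..x₂, a x ^ 2) * A t ^ 2 - (∫ x in x₁..x₂, a x * b x) * 2 * (A t * B t)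
        + (∫ x in x₁..x₂, b x ^ 2) * B t ^ 2 := by
    rw [← intervalIntegral.integral_mul_const, mul_assoc, ← intervalIntegral.integral_mul_const,
      ← intervalIntegral.integral_mul_const, ← intervalIntegral.integral_sub,
      ← intervalIntegral.integral_add]
    · congr 1
      ext x
      ring
    all_goals exact Continuous.intervalIntegrable (by fun_prop) _ _
  simp only [inner]
  rw [intervalIntegral.integral_add, intervalIntegral.integral_sub]
  · simp only [intervalIntegral.integral_const_mul]
    ring
  all_goals exact Continuous.intervalIntegrable (by fun_prop) _ _

lemma integral_hermite_sq (x0 : ℝ) {h : ℝ} (hh : h ≠ 0) {i : ℕ} (hi : i < 2) :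
    ∫ x in x0..(x0 + h), hermite x0 h i x ^ 2 = 13 / 35 * h := by
  interval_cases i
  · rw [integral_of_eval_affine x0 h 1 _ ![1, 0, -6, 4, 9, -12, 4]]
    · norm_num [Fin.sum_univ_succ]
      ring
    · intro c
      simp [hermite, Fin.sum_univ_succ, hh]
      ring
  · rw [integral_of_eval_affine x0 h 1 _ ![0, 0, 0, 0, 9, -12, 4]]
    · norm_num [Fin.sum_univ_succ]
      ring
    · intro c
      simp [hermite, Fin.sum_univ_succ, hh]
      ring

lemma integral_hermite_sub_sq (x0 : ℝ) {h : ℝ} (hh : h ≠ 0) {i : ℕ} (hi : i < 2) :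
    ∫ x in x0..(x0 + h), 
      (hermite x0 h i x * (x - (x0 + (i : ℝ) * h)) - hermite x0 h (i + 2) x) ^ 2 = 2 / 315 * h ^ 3 := by
  interval_cases i
  · rw [integral_of_eval_affine x0 h (h ^ 2) _ ![0, 0, 0, 0, 4, -16, 24, -16, 4]]
    · norm_num [Fin.sum_univ_succ]
      ring
    · intro c
      simp [hermite, Fin.sum_univ_succ, hh]
      ring
  · rw [integral_of_eval_affine x0 h (h ^ 2) _ ![0, 0, 0, 0, 4, -16, 24, -16, 4]]
    · norm_num [Fin.sum_univ_succ]
      ring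
    · intro c
      simp [hermite, Fin.sum_univ_succ, hh]
      ring

lemma integral_hermite_mul_sub_sq (x0 : ℝ) {h : ℝ} (hh : h ≠ 0) {i : ℕ} (hi : i < 2) :
    ∫ x in x0..(x0 + h), (hermite x0 h i x * (x - (x0 + (i : ℝ) * h))) ^ 2 = 19 / 630 * h ^ 3 := by
  interval_cases i
  · rw [integral_of_eval_affine x0 h (h ^ 2) _ ![0, 0, 1, 0, -6, 4, 9, -12, 4]]
    · norm_num [Fin.sum_univ_succ]
      ring
    · intro c
      simp [hermite, Fin.sum_univ_succ, hh]
      ring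
  · rw [integral_of_eval_affine x0 h (h ^ 2) _ ![0, 0, 0, 0, 9, -30, 37, -20, 4]]
    · norm_num [Fin.sum_univ_succ]
      ring
    · intro c
      simp [hermite, Fin.sum_univ_succ, hh]
      ring

lemma integral_hermite_mul_sub_mul (x0 : ℝ) {h : ℝ} (hh : h ≠ 0) {i : ℕ} (hi : i < 2) :
    ∫ x in x0..(x0 + h), 
      (hermite x0 h i x * (x - (x0 + (i : ℝ) * h))) * hermite x0 h (i + 2) x = 1 / 60 * h ^ 3 := by
  interval_cases i
  · rw [integral_of_eval_affine x0 h (h ^ 2) _ ![0, 0, 1, -2, -2, 8, -7, 2]]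
    · norm_num [Fin.sum_univ_succ]
      ring
    · intro c
      simp [hermite, Fin.sum_univ_succ, hh]
      ring
  · rw [integral_of_eval_affine x0 h (h ^ 2) _ ![0, 0, 0, 0, 3, -8, 7, -2]]
    · norm_num [Fin.sum_univ_succ]
      ring
    · intro c
      simp [hermite, Fin.sum_univ_succ, hh]
      ring

lemma integral_hermite_add_two_sq (x0 : ℝ) {h : ℝ} (hh : h ≠ 0) {i : ℕ} (hi : i < 2) :
    ∫ x in x0..(x0 + h), hermite x0 h (i + 2) x ^ 2 = 1 / 105 * h ^ 3 := by
  interval_cases i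
  · rw [integral_of_eval_affine x0 h (h ^ 2) _ ![0, 0, 1, -4, 6, -4, 1]]
    · norm_num [Fin.sum_univ_succ]
      ring
    · intro c
      simp [hermite, Fin.sum_univ_succ, hh]
      ring
  · rw [integral_of_eval_affine x0 h (h ^ 2) _ ![0, 0, 0, 0, 1, -2, 1]]
    · norm_num [Fin.sum_univ_succ]
      ring
    · intro c
      simp [hermite, Fin.sum_univ_succ, hh]
      ring

/-- Exact values of the Hermite error integrals (the computations of
Section 3.3). -/
theorem hermite_error_integrals
    (xk tl dx dt : ℝ) (hdx : 0 < dx) (hdt : 0 < dt) :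
    (∑ i ∈ Finset.range 2, ∑ j ∈ Finset.range 2,
        ∫ t in tl..(tl + dt), ∫ x in xk..(xk + dx), (mker xk dx tl dt i j x t)^2)
      = 104 / 11025 * dx^3 * dt ∧
    (∑ i ∈ Finset.range 2, ∑ j ∈ Finset.range 2,
        ∫ t in tl..(tl + dt), ∫ x in xk..(xk + dx), (nker xk dx tl dt i j x t)^2)
      = 104 / 11025 * dx * dt^3 ∧
    (∑ i ∈ Finset.range 2, ∑ j ∈ Finset.range 2,
        ∫ t in tl..(tl + dt), ∫ x in xk..(xk + dx), (pker xk dx tl dt i j x t)^2)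
      = 353 / 198450 * dx^3 * dt^3 := by
  have sum_const {F : ℕ → ℕ → ℝ} {v : ℝ} (hF : ∀ i < 2, ∀ j < 2, F i j = v) :
      ∑ i ∈ Finset.range 2, ∑ j ∈ Finset.range 2, F i j = 4 * v := by
    simp only [Finset.sum_range_succ, Finset.sum_range_zero, hF 0 two_pos 0 two_pos,
      hF 0 two_pos 1 one_lt_two, hF 1 one_lt_two 0 two_pos, hF 1 one_lt_two 1 one_lt_two]
    ring
  refine ⟨?_, ?_, ?_⟩
  · rw [sum_const (v := 2 / 315 * dx ^ 3 * (13 / 35 * dt))]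
    · ring
    · intro i hi j hj
      simp only [mker, mul_pow, intervalIntegral.integral_mul_const,
        intervalIntegral.integral_const_mul, integral_hermite_sub_sq xk hdx.ne' hi,
        integral_hermite_sq tl hdt.ne' hj]
  · rw [sum_const (v := 13 / 35 * dx * (2 / 315 * dt ^ 3))]
    · ring
    · intro i hi j hj
      simp only [nker, mul_pow, intervalIntegral.integral_mul_const,
        intervalIntegral.integral_const_mul, integral_hermite_sub_sq tl hdt.ne' hj,
        integral_hermite_sq xk hdx.ne' hi]
  · rw [sum_const (v := 353 / 793800 * dx ^ 3 * dt ^ 3)]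
    · ring
    · intro i hi j hj
      have cont (x0 h : ℝ) (i : ℕ) :
          Continuous fun x => hermite x0 h i x * (x - (x0 + (i : ℝ) * h)) :=
        (continuous_hermite x0 h i).mul (by fun_prop)
      have key := integral_integral_mul_sub_mul_sq (cont xk dx i)
        (continuous_hermite xk dx (i + 2)) (cont tl dt j) (continuous_hermite tl dt (j + 2))
        xk (xk + dx) tl (tl + dt)
      rw [integral_hermite_mul_sub_sq xk hdx.ne' hi, integral_hermite_mul_sub_sq tl hdt.ne' hj,
        integral_hermite_mul_sub_mul xk hdx.ne' hi, integral_hermite_mul_sub_mul tl hdt.ne' hj,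
        integral_hermite_add_two_sq xk hdx.ne' hi, integral_hermite_add_two_sq tl hdt.ne' hj]
        at key
      have pker_eq (x t : ℝ) : pker xk dx tl dt i j x t =
          hermite xk dx i x * (x - (xk + (i : ℝ) * dx)) *
            (hermite tl dt j t * (t - (tl + (j : ℝ) * dt))) -
          hermite xk dx (i + 2) x * hermite tl dt (j + 2) t := by
        unfold pker
        ring
      simp only [pker_eq, key]
      ring
end
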